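/- arXiv:math/0408390 — 3 statements merged into one kernel-verified Lean document; each statement's English description precedes it below -/
import Mathlib

section
/- Let A, A* be a Leonard pair on V. Then A is multiplicity-free: A has d+1 mutually distinct eigenvalues, all contained in K, and V is the direct sum of the corresponding one-dimensional eigenspaces of A. The same conclusion holds for A*. -/
open LinearMap Polynomial

def IsIrredTridiag {K : Type*} [Field K] {n : ℕ} (M : Matrix (Fin n) (Fin n) K) : Prop :=
  (∀ i j : Fin n, 1 < ((i : ℤ) - (j : ℤ)).natAbs → M i j = 0) ∧
  (∀ i j : Fin n, ((i : ℤ) - (j : ℤ)).natAbs = 1 → M i j ≠ 0)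

def IsLeonardPair {K V : Type*} [Field K] [AddCommGroup V] [Module K V]
    (d : ℕ) (A As : V →ₗ[K] V) : Prop :=
  (∃ b : Module.Basis (Fin (d + 1)) K V,
      IsIrredTridiag (LinearMap.toMatrix b b A) ∧ (LinearMap.toMatrix b b As).IsDiag) ∧
  (∃ b : Module.Basis (Fin (d + 1)) K V,
      IsIrredTridiag (LinearMap.toMatrix b b As) ∧ (LinearMap.toMatrix b b A).IsDiag)

theorem tridiag_eigen_zero {K V : Type*} [Field K] [AddCommGroup V] [Module K V]
    {d : ℕ} {A : V →ₗ[K] V} (b : Module.Basis (Fin (d + 1)) K V)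
    (hb : IsIrredTridiag (LinearMap.toMatrix b b A)) {t : K} {v : V}
    (hv : A v = t • v) (h0 : b.repr v 0 = 0) : v = 0 := by
  have key : ∀ n : ℕ, ∀ hn : n < d + 1, b.repr v ⟨n, hn⟩ = 0 := by
    intro n
    induction n using Nat.strong_induction_on with
    | _ n ih =>
      intro hn
      rcases n with _ | m
      · exact h0
      · have hm : m < d + 1 := by omega
        have e := congrFun (LinearMap.toMatrix_mulVec_repr b b A v) ⟨m, hm⟩
        rw [hv, map_smul, Finsupp.smul_apply, ih m (by omega) hm, smul_zero] at e
        rw [Matrix.mulVec, dotProduct, Finset.sum_eq_single ⟨m + 1, hn⟩] at e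
        · exact (mul_eq_zero.mp e).resolve_left (hb.2 _ _ (by simp))
        · intro j _ hj
          rcases lt_or_ge (j : ℕ) (m + 1) with h | h
          · have := ih j h j.2
            rw [Fin.eta] at this
            rw [this, mul_zero]
          · have hne : (j : ℕ) ≠ m + 1 := fun h' => hj (Fin.ext h')
            rw [hb.1 _ _ (by simp only []; omega), zero_mul]
        · simp
  apply b.ext_elem
  intro i
  rw [map_zero, Finsupp.zero_apply]
  exact key i i.2

theorem tridiag_diag_multfree {K V : Type*} [Field K] [AddCommGroup V] [Module K V]
    {d : ℕ} {A : V →ₗ[K] V} (b c : Module.Basis (Fin (d + 1)) K V)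
    (hb : IsIrredTridiag (LinearMap.toMatrix b b A))
    (hc : (LinearMap.toMatrix c c A).IsDiag) :
    ∃ θ : Fin (d + 1) → K, Function.Injective θ ∧
      (∀ i, Module.finrank K (Module.End.eigenspace A (θ i)) = 1) ∧
      DirectSum.IsInternal (fun i => Module.End.eigenspace A (θ i)) := by
  set θ : Fin (d + 1) → K := fun i => LinearMap.toMatrix c c A i i with hθ
  have hA : ∀ i, A (c i) = θ i • c i := by
    intro i
    apply c.ext_elem
    intro j
    have e : LinearMap.toMatrix c c A j i = c.repr (A (c i)) j := LinearMap.toMatrix_apply ..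
    rw [← e, map_smul, Finsupp.smul_apply, c.repr_self]
    by_cases h : i = j
    · subst h; simp [hθ]
    · rw [hc (Ne.symm h), Finsupp.single_eq_of_ne (Ne.symm h), smul_zero]
  have hc0 : ∀ i, b.repr (c i) 0 ≠ 0 := fun i h =>
    c.ne_zero i (tridiag_eigen_zero b hb (hA i) h)
  have hspan : ∀ i w, A w = θ i • w → (b.repr w 0 / b.repr (c i) 0) • c i = w := by
    intro i w hw
    have : w - (b.repr w 0 / b.repr (c i) 0) • c i = 0 := by
      apply tridiag_eigen_zero b hb (t := θ i)
      · rw [map_sub, map_smul, hw, hA, smul_sub, smul_comm]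
      · simp [div_mul_cancel₀ _ (hc0 i)]
    exact (sub_eq_zero.mp this).symm
  have hinj : Function.Injective θ := by
    intro i j hij
    by_contra hne
    have h1 := hspan i (c j) (by rw [hA, hij])
    have h2 := congrArg (fun x => c.repr x j) h1
    simp [Finsupp.single_eq_of_ne (Ne.symm hne)] at h2
  refine ⟨θ, hinj, ?_, ?_⟩
  · intro i
    rw [finrank_eq_one_iff']
    refine ⟨⟨c i, Module.End.mem_eigenspace_iff.mpr (hA i)⟩, ?_, ?_⟩
    · intro h
      exact c.ne_zero i (congrArg Subtype.val h)
    · rintro ⟨w, hw⟩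
      exact ⟨_, Subtype.ext (hspan i w (Module.End.mem_eigenspace_iff.mp hw))⟩
  · rw [DirectSum.isInternal_submodule_iff_iSupIndep_and_iSup_eq_top]
    refine ⟨(Module.End.eigenspaces_iSupIndep A).comp hinj, ?_⟩
    rw [eq_top_iff, ← c.span_eq, Submodule.span_le]
    rintro _ ⟨i, rfl⟩
    exact Submodule.mem_iSup_of_mem i (Module.End.mem_eigenspace_iff.mpr (hA i))

/-- In a Leonard pair, each of `A`, `A*` is multiplicity-free:
it has `d+1` mutually distinct eigenvalues in `K`, and `V` is the direct sum of the
corresponding one-dimensional eigenspaces. -/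
theorem leonard_pair_multiplicity_free
    {K V : Type*} [Field K] [AddCommGroup V] [Module K V] [FiniteDimensional K V]
    (d : ℕ) (hdim : Module.finrank K V = d + 1)
    (A As : V →ₗ[K] V) (h : IsLeonardPair d A As) :
    (∃ θ : Fin (d + 1) → K, Function.Injective θ ∧
      (∀ i, Module.finrank K (Module.End.eigenspace A (θ i)) = 1) ∧
      DirectSum.IsInternal (fun i => Module.End.eigenspace A (θ i))) ∧
    (∃ θ : Fin (d + 1) → K, Function.Injective θ ∧
      (∀ i, Module.finrank K (Module.End.eigenspace As (θ i)) = 1) ∧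
      DirectSum.IsInternal (fun i => Module.End.eigenspace As (θ i))) := by
  obtain ⟨⟨b, hb, hb'⟩, ⟨c, hc, hc'⟩⟩ := h
  exact ⟨tridiag_diag_multfree b c hb hc', tridiag_diag_multfree c b hc hb'⟩
end

section
/- Let A, A* be a Leonard pair on V. Then the K-subalgebra of End_K(V) generated by A and A* is equal to End_K(V), the algebra of all K-linear maps from V to V. -/
open LinearMap Polynomial

lemma tridiag_eigen_zero_s4 {K : Type*} [Field K] {n : ℕ} (M : Matrix (Fin (n+1)) (Fin (n+1)) K)
    (hM : IsIrredTridiag M) (t : K) (x : Fin (n+1) → K) (hx : M.mulVec x = t • x)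
    (h0 : x 0 = 0) : x = 0 := by
  have key : ∀ k : ℕ, ∀ hk : k < n + 1, x ⟨k, hk⟩ = 0 := by
    intro k
    induction k using Nat.strong_induction_on with
    | _ k ih =>
      intro hk
      rcases k with _ | k
      · exact h0
      · have hk' : k < n + 1 := by omega
        have h1 := congrFun hx ⟨k, hk'⟩
        rw [Pi.smul_apply, ih k (by omega) hk', smul_zero, Matrix.mulVec, dotProduct,
          Finset.sum_eq_single (⟨k+1, hk⟩ : Fin (n+1))] at h1
        · rcases mul_eq_zero.mp h1 with h2 | h2
          · exact absurd h2 (hM.2 _ _ (by simp))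
          · exact h2
        · intro j _ hj
          by_cases hjk : (j : ℕ) < k + 1
          · have := ih j hjk j.2
            rw [show x j = 0 from this, mul_zero]
          · have : (j : ℕ) ≠ k + 1 := fun h => hj (Fin.ext h)
            rw [hM.1 _ _ (by simp only; omega), zero_mul]
        · simp
  funext i
  exact key i i.2

lemma matrix_gen {K : Type*} [Field K] {n : ℕ}
    (T : Subalgebra K (Matrix (Fin (n+1)) (Fin (n+1)) K))
    (M : Matrix (Fin (n+1)) (Fin (n+1)) K) (hM : IsIrredTridiag M) (hMT : M ∈ T)
    (t : Fin (n+1) → K) (ht : Function.Injective t) (hD : Matrix.diagonal t ∈ T) : T = ⊤ := by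
  have hE : ∀ i, Matrix.single i i (1 : K) ∈ T := by
    intro i
    have h1 : aeval (Matrix.diagonal t) (Lagrange.basis Finset.univ t i) ∈ T :=
      (Algebra.adjoin_le (by simpa using hD)) (aeval_mem_adjoin_singleton K _)
    have h2 : aeval (Matrix.diagonal t) (Lagrange.basis Finset.univ t i)
        = Matrix.single i i (1 : K) := by
      have h3 := aeval_algHom_apply (Matrix.diagonalAlgHom (n := Fin (n+1)) (α := K) K) t
        (Lagrange.basis Finset.univ t i)
      simp only [Matrix.diagonalAlgHom_apply] at h3
      rw [h3, ← Matrix.diagonal_single]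
      congr 1
      funext j
      have h4 : (aeval t (Lagrange.basis Finset.univ t i)) j
          = eval (t j) (Lagrange.basis Finset.univ t i) := by
        have := aeval_algHom_apply (Pi.evalAlgHom K (fun _ : Fin (n+1) => K) j) t
          (Lagrange.basis Finset.univ t i)
        simpa [aeval_def, eval₂_eq_eval_map] using this.symm
      rw [h4]
      by_cases hij : i = j
      · subst hij
        rw [Lagrange.eval_basis_self ht.injOn (Finset.mem_univ _)]
        simp
      · rw [Lagrange.eval_basis_of_ne hij (Finset.mem_univ _)]
        simp [Ne.symm hij]
    rwa [h2] at h1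
  have hadj : ∀ i j : Fin (n+1), ((i : ℤ) - (j : ℤ)).natAbs = 1 →
      Matrix.single i j (1 : K) ∈ T := by
    intro i j hij
    have h1 := T.smul_mem (T.mul_mem (T.mul_mem (hE i) hMT) (hE j)) (M i j)⁻¹
    have h0 := hM.2 i j hij
    rw [Matrix.single_mul_mul_single] at h1
    simpa [h0, Matrix.smul_single] using h1
  have hk : ∀ k : ℕ, ∀ hk : k < n + 1, Matrix.single (⟨k, hk⟩ : Fin (n+1)) 0 (1 : K) ∈ T ∧
      Matrix.single 0 (⟨k, hk⟩ : Fin (n+1)) (1 : K) ∈ T := by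
    intro k
    induction k with
    | zero => intro hk; exact ⟨hE 0, hE 0⟩
    | succ k ih =>
      intro hk
      obtain ⟨ha, hb⟩ := ih (by omega)
      have h1 := T.mul_mem (hadj ⟨k+1, hk⟩ ⟨k, by omega⟩ (by simp)) ha
      have h2 := T.mul_mem hb (hadj ⟨k, by omega⟩ ⟨k+1, hk⟩ (by simp))
      rw [Matrix.single_mul_single_same, one_mul] at h1 h2
      exact ⟨h1, h2⟩
  rw [eq_top_iff]
  intro X _
  rw [Matrix.matrix_eq_sum_single X]
  refine T.sum_mem fun i _ => T.sum_mem fun j _ => ?_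
  have h1 := T.smul_mem (T.mul_mem (hk i i.2).1 (hk j j.2).2) (X i j)
  rw [Matrix.single_mul_single_same] at h1
  simpa [Matrix.smul_single] using h1

/-- `A` and `A*` together generate all of `End_K(V)` as a `K`-algebra. -/
theorem leonard_pair_generates
    {K V : Type*} [Field K] [AddCommGroup V] [Module K V] [FiniteDimensional K V]
    (d : ℕ) (hdim : Module.finrank K V = d + 1)
    (A As : V →ₗ[K] V) (h : IsLeonardPair d A As) :
    Algebra.adjoin K ({A, As} : Set (Module.End K V)) = ⊤ := by
  obtain ⟨⟨b, hA, hAs⟩, ⟨c, hc, -⟩⟩ := h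
  set t := (LinearMap.toMatrix b b As).diag with ht
  have hdiag : Matrix.diagonal t = LinearMap.toMatrix b b As := hAs.diagonal_diag
  have heig : ∀ i, As (b i) = t i • b i := by
    intro i
    apply b.repr.injective
    ext j
    rw [← LinearMap.toMatrix_apply, ← hdiag]
    by_cases hij : j = i
    · subst hij; simp
    · simp [hij, Matrix.diagonal_apply_ne, Finsupp.single_apply, Ne.symm hij]
  have hev : ∀ (s : K) (v : V), As v = s • v → c.repr v 0 = 0 → v = 0 := by
    intro s v hv h0
    have h1 := tridiag_eigen_zero_s4 _ hc s (c.repr v)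
      (by rw [LinearMap.toMatrix_mulVec_repr, hv]; simp) h0
    apply c.repr.injective
    ext j
    simpa using congrFun h1 j
  have hinj : Function.Injective t := by
    intro i j hij
    by_contra hne
    have h1 := hev (t i) ((c.repr (b j) 0) • b i - (c.repr (b i) 0) • b j)
      (by rw [map_sub, map_smul, map_smul, heig, heig, ← hij, smul_sub, smul_comm,
            smul_comm (t i) _ (b j)])
      (by simp [mul_comm])
    have h2 := congrArg (fun v => b.repr v j) h1
    simp [Finsupp.single_apply, hne] at h2
    exact b.ne_zero i (hev (t i) (b i) (heig i) h2)
  set S := Algebra.adjoin K ({A, As} : Set (Module.End K V)) with hS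
  have hT := matrix_gen (S.map (LinearMap.toMatrixAlgEquiv b).toAlgHom) _ hA
    ⟨A, Algebra.subset_adjoin (by simp), rfl⟩ t hinj
    (by rw [hdiag]; exact ⟨As, Algebra.subset_adjoin (by simp), rfl⟩)
  rw [eq_top_iff]
  intro X _
  have hX : LinearMap.toMatrixAlgEquiv b X ∈ S.map (LinearMap.toMatrixAlgEquiv b).toAlgHom := by
    rw [hT]; trivial
  obtain ⟨Y, hY, hYX⟩ := hX
  have : Y = X := (LinearMap.toMatrixAlgEquiv b).injective hYX
  exact this ▸ hY
end

section
/- Let A, A* be a Leonard pair on V. Then there exists a unique map † : End_K(V) → End_K(V) that is a bijective K-linear map satisfying (XY)† = Y† X† for all X, Y ∈ End_K(V), together with A† = A and (A*)† = A*. Moreover this map is an involution: (X†)† = X for all X ∈ End_K(V). -/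
open LinearMap Polynomial

lemma leo_tridiag_zero {K : Type*} [Field K] {d : ℕ} (T : Matrix (Fin (d+1)) (Fin (d+1)) K)
    (hT : IsIrredTridiag T) (θ : K) (v : Fin (d+1) → K) (hv : T.mulVec v = θ • v)
    (h0 : v 0 = 0) : v = 0 := by
  have key : ∀ n : ℕ, ∀ h : n < d + 1, v ⟨n, h⟩ = 0 := by
    intro n
    induction n using Nat.strong_induction_on with
    | _ n ih =>
      intro h
      rcases n with _ | n
      · exact h0
      · have hr := congrFun hv ⟨n, by omega⟩
        simp only [Matrix.mulVec, dotProduct, Pi.smul_apply, smul_eq_mul] at hr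
        rw [ih n (by omega) (by omega), mul_zero,
          Finset.sum_eq_single (⟨n+1, h⟩ : Fin (d+1))] at hr
        · rcases mul_eq_zero.1 hr with h1 | h1
          · exact absurd h1 (hT.2 _ _ (by simp))
          · exact h1
        · intro j _ hj
          by_cases hjn : (j : ℕ) ≤ n
          · rw [show v j = 0 from ih j (by omega) j.2, mul_zero]
          · rw [hT.1, zero_mul]
            have : (j : ℕ) ≠ n + 1 := fun e => hj (Fin.ext e)
            simp only
            omega
        · intro h; exact absurd (Finset.mem_univ _) h
  funext i
  exact key i i.2

lemma leo_symm {K : Type*} [Field K] {d : ℕ} (T : Matrix (Fin (d+1)) (Fin (d+1)) K)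
    (hT : IsIrredTridiag T) :
    ∃ s : Fin (d+1) → K, (∀ i, s i ≠ 0) ∧ ∀ i j, s i * T i j = s j * T j i := by
  let s : Fin (d+1) → K := fun i => Fin.induction (motive := fun _ => K) (1 : K)
    (fun k x => x * T k.castSucc k.succ / T k.succ k.castSucc) i
  have hs0 : s 0 = 1 := rfl
  have hss : ∀ k : Fin d, s k.succ = s k.castSucc * T k.castSucc k.succ / T k.succ k.castSucc :=
    fun k => Fin.induction_succ ..
  have n1 : ∀ k : Fin d, T k.castSucc k.succ ≠ 0 := fun k => hT.2 _ _ (by simp)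
  have n2 : ∀ k : Fin d, T k.succ k.castSucc ≠ 0 := fun k => hT.2 _ _ (by simp)
  have hadj : ∀ k : Fin d, s k.succ * T k.succ k.castSucc = s k.castSucc * T k.castSucc k.succ := by
    intro k
    rw [hss, div_mul_cancel₀ _ (n2 k)]
  have hup : ∀ i j : Fin (d+1), (j : ℕ) = i + 1 → s i * T i j = s j * T j i := by
    intro i j hij
    have := hadj ⟨i, by omega⟩
    have e1 : (⟨i, by omega⟩ : Fin d).castSucc = i := rfl
    have e2 : (⟨i, by omega⟩ : Fin d).succ = j := Fin.ext (by simp [hij])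
    rw [e1, e2] at this
    exact this.symm
  refine ⟨s, ?_, ?_⟩
  · intro i
    induction i using Fin.induction with
    | zero => rw [hs0]; exact one_ne_zero
    | succ k ih => rw [hss]; exact div_ne_zero (mul_ne_zero ih (n1 k)) (n2 k)
  · intro i j
    by_cases h1 : (j : ℕ) = i + 1
    · exact hup i j h1
    by_cases h2 : (i : ℕ) = j + 1
    · exact (hup j i h2).symm
    by_cases h3 : i = j
    · rw [h3]
    have : (i : ℕ) ≠ j := fun e => h3 (Fin.ext e)
    rw [hT.1 i j (by omega), hT.1 j i (by omega), mul_zero, mul_zero]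

lemma leo_gen {K : Type*} [Field K] {d : ℕ} (T : Matrix (Fin (d+1)) (Fin (d+1)) K)
    (hT : IsIrredTridiag T) (θ : Fin (d+1) → K) (hθ : Function.Injective θ)
    (S : Subalgebra K (Matrix (Fin (d+1)) (Fin (d+1)) K)) (h1 : T ∈ S)
    (h2 : Matrix.diagonal θ ∈ S) : ∀ M, M ∈ S := by
  have hE : ∀ i, Matrix.single i i (1 : K) ∈ S := by
    intro i
    have h3 : Polynomial.aeval (Matrix.diagonal θ) (Lagrange.basis Finset.univ θ i) ∈ S :=
      by
      have := Polynomial.aeval_mem_adjoin_singleton K (Matrix.diagonal θ) (p := Lagrange.basis Finset.univ θ i)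
      exact Algebra.adjoin_le (by simpa using h2) this
    have h4 : Polynomial.aeval (Matrix.diagonal θ) (Lagrange.basis Finset.univ θ i)
        = Matrix.single i i (1 : K) := by
      have := Polynomial.aeval_algHom_apply (Matrix.diagonalAlgHom K (n := Fin (d+1)) (α := K)) θ
        (Lagrange.basis Finset.univ θ i)
      simp only [Matrix.diagonalAlgHom_apply] at this
      rw [this, ← Matrix.diagonal_single]
      congr 1
      funext j
      rw [Polynomial.aeval_pi_apply₂, Polynomial.coe_aeval_eq_eval]
      by_cases hij : i = j
      · subst hij
        rw [Lagrange.eval_basis_self hθ.injOn (Finset.mem_univ _)]; simp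
      · rw [Lagrange.eval_basis_of_ne hij (Finset.mem_univ _)]
        simp [Pi.single_apply, Ne.symm hij]
    rwa [h4] at h3
  have hadj : ∀ i j : Fin (d+1), ((i : ℤ) - (j : ℤ)).natAbs = 1 → Matrix.single i j (1 : K) ∈ S := by
    intro i j hij
    have h3 := S.smul_mem (S.mul_mem (S.mul_mem (hE i) h1) (hE j)) (T i j)⁻¹
    rw [Matrix.single_mul_mul_single, Matrix.smul_single] at h3
    simpa [hT.2 i j hij] using h3
  have htr : ∀ i j k : Fin (d+1), Matrix.single i j (1 : K) ∈ S → Matrix.single j k (1 : K) ∈ S →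
      Matrix.single i k (1 : K) ∈ S := by
    intro i j k h3 h4
    have := S.mul_mem h3 h4
    simpa using this
  have h0 : ∀ j : Fin (d+1), Matrix.single 0 j (1 : K) ∈ S ∧ Matrix.single j 0 (1 : K) ∈ S := by
    intro j
    induction j using Fin.induction with
    | zero => exact ⟨hE 0, hE 0⟩
    | succ k ih =>
      exact ⟨htr _ _ _ ih.1 (hadj _ _ (by simp)), htr _ _ _ (hadj _ _ (by simp)) ih.2⟩
  intro M
  rw [Matrix.matrix_eq_sum_single M]
  refine S.sum_mem fun i _ => S.sum_mem fun j _ => ?_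
  have := S.smul_mem (htr _ _ _ (h0 i).2 (h0 j).1) (M i j)
  simpa [Matrix.smul_single] using this

lemma leo_unit {K V : Type*} [Field K] [AddCommGroup V] [Module K V]
    (f : (V →ₗ[K] V) →ₗ[K] (V →ₗ[K] V)) (hf : Function.Bijective f)
    (hm : ∀ X Y : V →ₗ[K] V, f (X ∘ₗ Y) = f Y ∘ₗ f X) : f 1 = 1 := by
  obtain ⟨Y, hY⟩ := hf.2 1
  have := hm Y 1
  rw [hY] at this
  have e : Y ∘ₗ (1 : V →ₗ[K] V) = Y := rfl
  rw [e, hY] at this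
  exact this.symm

/-- The subalgebra where two antiautomorphisms agree. -/
def leoEq {K V : Type*} [Field K] [AddCommGroup V] [Module K V]
    (f g : (V →ₗ[K] V) →ₗ[K] (V →ₗ[K] V)) (h1 : f 1 = g 1)
    (hf : ∀ X Y : V →ₗ[K] V, f (X ∘ₗ Y) = f Y ∘ₗ f X)
    (hg : ∀ X Y : V →ₗ[K] V, g (X ∘ₗ Y) = g Y ∘ₗ g X) : Subalgebra K (Module.End K V) where
  carrier := {X | f X = g X}
  mul_mem' := by
    intro a b ha hb
    change f (a ∘ₗ b) = g (a ∘ₗ b)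
    rw [hf, hg, ha, hb]
  add_mem' := by
    intro a b ha hb
    change f (a + b) = g (a + b)
    rw [map_add, map_add, ha, hb]
  algebraMap_mem' := by
    intro r
    change f _ = g _
    rw [Algebra.algebraMap_eq_smul_one]
    exact (f.map_smul r 1).trans ((congrArg (r • ·) h1).trans (g.map_smul r 1).symm)

lemma leo_inj {K V : Type*} [Field K] [AddCommGroup V] [Module K V] {d : ℕ}
    (As : V →ₗ[K] V) (b b' : Module.Basis (Fin (d + 1)) K V) (θ : Fin (d+1) → K)
    (hθ : ∀ i, As (b i) = θ i • b i) (hT : IsIrredTridiag (LinearMap.toMatrix b' b' As)) :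
    Function.Injective θ := by
  have key : ∀ (t : K) (v : V), As v = t • v → b'.repr v 0 = 0 → v = 0 := by
    intro t v hv h0
    have := leo_tridiag_zero _ hT t (b'.repr v) (by
      rw [LinearMap.toMatrix_mulVec_repr b' b', hv]; simp) h0
    apply b'.repr.injective
    ext i
    simpa using congrFun this i
  intro i j hij
  by_contra hne
  have h1 := key (θ i) (b'.repr (b j) 0 • b i - b'.repr (b i) 0 • b j) (by
    rw [map_sub, map_smul, map_smul, hθ, hθ, ← hij, smul_sub, smul_comm (θ i), smul_comm (θ i)])
    (by simp [mul_comm])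
  have h2 := congrArg (fun v => b.repr v j) h1
  simp [Finsupp.single_apply, hne] at h2
  exact b.ne_zero i (key _ _ (hθ i) h2)

lemma leo_exists {K V : Type*} [Field K] [AddCommGroup V] [Module K V] {d : ℕ}
    (A As : V →ₗ[K] V) (b : Module.Basis (Fin (d + 1)) K V)
    (hT : IsIrredTridiag (LinearMap.toMatrix b b A)) (hD : (LinearMap.toMatrix b b As).IsDiag) :
    ∃ f : (V →ₗ[K] V) →ₗ[K] (V →ₗ[K] V), (∀ X, f (f X) = X) ∧
      (∀ X Y : V →ₗ[K] V, f (X ∘ₗ Y) = f Y ∘ₗ f X) ∧ f A = A ∧ f As = As := by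
  obtain ⟨s, hs, hsym⟩ := leo_symm _ hT
  let f : (V →ₗ[K] V) →ₗ[K] (V →ₗ[K] V) :=
    { toFun := fun X => Matrix.toLin b b
        (Matrix.diagonal (fun i => (s i)⁻¹) * (LinearMap.toMatrix b b X).transpose * Matrix.diagonal s)
      map_add' := fun X Y => by
        simp [Matrix.mul_add, Matrix.add_mul]
      map_smul' := fun r X => by
        simp }
  have hf : ∀ X, LinearMap.toMatrix b b (f X) =
      Matrix.diagonal (fun i => (s i)⁻¹) * (LinearMap.toMatrix b b X).transpose * Matrix.diagonal s :=
    fun X => LinearMap.toMatrix_toLin b b _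
  have hfe : ∀ X i j, LinearMap.toMatrix b b (f X) i j =
      (s i)⁻¹ * LinearMap.toMatrix b b X j i * s j := by
    intro X i j
    rw [hf, Matrix.mul_diagonal, Matrix.diagonal_mul, Matrix.transpose_apply]
  have hinj : ∀ X Y : V →ₗ[K] V, (∀ i j, LinearMap.toMatrix b b X i j = LinearMap.toMatrix b b Y i j)
      → X = Y := fun X Y h => (LinearMap.toMatrix b b).injective (Matrix.ext h)
  refine ⟨f, ?_, ?_, ?_, ?_⟩
  · intro X
    apply hinj
    intro i j
    rw [hfe, hfe]
    have := hs i
    have := hs j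
    field_simp
  · intro X Y
    apply hinj
    intro i j
    rw [hfe, LinearMap.toMatrix_comp b b b, LinearMap.toMatrix_comp b b b, Matrix.mul_apply,
      Matrix.mul_apply, Finset.mul_sum, Finset.sum_mul]
    refine Finset.sum_congr rfl fun k _ => ?_
    rw [hfe, hfe]
    have := hs k
    field_simp
  · apply hinj
    intro i j
    rw [hfe, mul_assoc, mul_comm _ (s j), ← hsym i j, inv_mul_cancel_left₀ (hs i)]
  · apply hinj
    intro i j
    rw [hfe]
    by_cases hij : i = j
    · subst hij
      have := hs i
      field_simp
    · rw [hD hij, hD (Ne.symm hij)]; simp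

/-- there is a unique antiautomorphism `†` of `End_K(V)` (a bijective
`K`-linear map with `(XY)† = Y† X†`) fixing `A` and `A*`; moreover it is an involution. -/
theorem leonard_pair_antiautomorphism
    {K V : Type*} [Field K] [AddCommGroup V] [Module K V] [FiniteDimensional K V]
    (d : ℕ) (hdim : Module.finrank K V = d + 1)
    (A As : V →ₗ[K] V) (h : IsLeonardPair d A As) :
    (∃! f : (V →ₗ[K] V) →ₗ[K] (V →ₗ[K] V),
      Function.Bijective f ∧ (∀ X Y : V →ₗ[K] V, f (X ∘ₗ Y) = f Y ∘ₗ f X) ∧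
      f A = A ∧ f As = As) ∧
    (∀ f : (V →ₗ[K] V) →ₗ[K] (V →ₗ[K] V),
      (Function.Bijective f ∧ (∀ X Y : V →ₗ[K] V, f (X ∘ₗ Y) = f Y ∘ₗ f X) ∧
        f A = A ∧ f As = As) →
      ∀ X : V →ₗ[K] V, f (f X) = X) := by
  obtain ⟨⟨b, hT, hD⟩, b', hT', -⟩ := h
  obtain ⟨f, hff, hfm, hfA, hfAs⟩ := leo_exists A As b hT hD
  have hfb : Function.Bijective f := (show Function.Involutive f from hff).bijective
  set θ : Fin (d+1) → K := (LinearMap.toMatrix b b As).diag with hθdef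
  have hdiag : Matrix.diagonal θ = LinearMap.toMatrix b b As := hD.diagonal_diag
  have hθ : ∀ i, As (b i) = θ i • b i := by
    intro i
    have h1 := Matrix.toLin_self b b (LinearMap.toMatrix b b As) i
    rw [Matrix.toLin_toMatrix, ← hdiag] at h1
    rw [h1, Finset.sum_eq_single i]
    · simp
    · intro j _ hj
      rw [Matrix.diagonal_apply_ne _ hj, zero_smul]
    · simp
  have hinj := leo_inj As b b' θ hθ hT'
  have huniq : ∀ g : (V →ₗ[K] V) →ₗ[K] (V →ₗ[K] V),
      (Function.Bijective g ∧ (∀ X Y : V →ₗ[K] V, g (X ∘ₗ Y) = g Y ∘ₗ g X) ∧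
        g A = A ∧ g As = As) → g = f := by
    rintro g ⟨hgb, hgm, hgA, hgAs⟩
    let S := leoEq g f ((leo_unit g hgb hgm).trans (leo_unit f hfb hfm).symm) hgm hfm
    have hall := leo_gen _ hT θ hinj (S.comap (Matrix.toLinAlgEquiv b).toAlgHom)
      (by
        change g (Matrix.toLin b b _) = f (Matrix.toLin b b _)
        rw [Matrix.toLin_toMatrix, hgA, hfA])
      (by
        change g (Matrix.toLin b b _) = f (Matrix.toLin b b _)
        rw [hdiag, Matrix.toLin_toMatrix, hgAs, hfAs])
    refine LinearMap.ext fun X => ?_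
    have h1 : g (Matrix.toLin b b _) = f (Matrix.toLin b b _) := hall (LinearMap.toMatrix b b X)
    rwa [Matrix.toLin_toMatrix] at h1
  refine ⟨⟨f, ⟨hfb, hfm, hfA, hfAs⟩, huniq⟩, ?_⟩
  intro g hg X
  rw [huniq g hg]
  exact hff X
end
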